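/- arXiv:0811.2246 — 3 statements merged into one kernel-verified Lean document; each statement's English description precedes it below -/
import Mathlib

section
/- Let $A$ be a commutative ring and let $I_1,\dots,I_N$ be ideals of $A$ such that for every $k$ with $2 \le k \le N$ one has $\left(\bigcap_{j=1}^{k-1} I_j\right) + I_k = \bigcap_{j=1}^{k-1}\left(I_j + I_k\right)$. If $f_1,\dots,f_N \in A$ satisfy $f_i - f_j \in I_i + I_j$ for all $i < j$, then there exists $f \in A$ such that $f - f_i \in I_i$ for every $i = 1,\dots,N$. -/
/-- Let `A` be a commutative ring and `I₁, …, I_N` ideals of `A` such that for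
every `k` with `2 ≤ k ≤ N` one has `(⋂_{j<k} I_j) + I_k = ⋂_{j<k} (I_j + I_k)`.
If `f₁, …, f_N ∈ A` satisfy `f_i - f_j ∈ I_i + I_j` for all `i < j`, then there exists `f ∈ A`
with `f - f_i ∈ I_i` for every `i`.  (Indices are `Fin N`, so the condition `2 ≤ k ≤ N` becomes
`1 ≤ (k : ℕ)`.) -/
theorem stmt_0 {A : Type*} [CommRing A] (N : ℕ) (I : Fin N → Ideal A)
    (hdist : ∀ k : Fin N, 1 ≤ (k : ℕ) →
      (⨅ j : Fin N, ⨅ _ : j < k, I j) + I k = ⨅ j : Fin N, ⨅ _ : j < k, (I j + I k))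
    (f : Fin N → A) (hf : ∀ i j : Fin N, i < j → f i - f j ∈ I i + I j) :
    ∃ g : A, ∀ i : Fin N, g - f i ∈ I i := by
  suffices h : ∀ n ≤ N, ∃ g : A, ∀ i : Fin N, (i : ℕ) < n → g - f i ∈ I i by
    obtain ⟨g, hg⟩ := h N le_rfl
    exact ⟨g, fun i => hg i i.isLt⟩
  intro n
  induction n with
  | zero => exact fun _ => ⟨0, fun i hi => absurd hi (Nat.not_lt_zero _)⟩
  | succ n ih =>
    intro hn
    obtain ⟨g, hg⟩ := ih (Nat.le_of_succ_le hn)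
    let k : Fin N := ⟨n, hn⟩
    have hmem : g - f k ∈ (⨅ j : Fin N, ⨅ _ : j < k, I j) + I k := by
      rcases Nat.eq_zero_or_pos n with rfl | hpos
      · refine Submodule.mem_sup_left ?_
        simp only [Submodule.mem_iInf]
        exact fun j hj => absurd hj (Nat.not_lt_zero _)
      · rw [hdist k hpos]
        simp only [Submodule.mem_iInf]
        intro j hj
        rw [← sub_add_sub_cancel g (f j) (f k)]
        exact add_mem (Submodule.mem_sup_left (hg j hj)) (hf j k hj)
    obtain ⟨a, ha, b, hb, hab⟩ := Submodule.mem_sup.mp hmem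
    simp only [Submodule.mem_iInf] at ha
    refine ⟨g - a, fun i hi => ?_⟩
    rcases Nat.lt_succ_iff_lt_or_eq.mp hi with hlt | heq
    · rw [sub_right_comm]
      exact sub_mem (hg i hlt) (ha i hlt)
    · obtain rfl : i = k := Fin.ext heq
      rwa [sub_right_comm, ← hab, add_sub_cancel_left]
end

section
/- Let $U \subseteq \mathbb{C}^n$ be open, let $1 \le q \le n$, and let $x_1,\dots,x_k : U \to \mathbb{C}$ be holomorphic functions (Fréchet $\mathbb{C}$-differentiable on $U$). Let $f_1,\dots,f_k : U \to \mathbb{C}$ be $C^\infty$ functions (infinitely $\mathbb{R}$-differentiable) each of which is holomorphic in the variables $z_l$ for all $l > q$, and set $f = \sum_{j=1}^k x_j f_j$. Then for every point $p \in U$ there exist an open set $V$ with $p \in V \subseteq U$ and $C^\infty$ functions $g_1,\dots,g_k : V \to \mathbb{C}$, each holomorphic in the variables $z_l$ for all $l > q$, such that the function $g = \sum_{j=1}^k x_j g_j$ satisfies $\frac{\partial g}{\partial \bar z_q} = f$ on $V$, and $g$ is holomorphic in the variables $z_l$ for all $l > q$. -/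
/-- The Wirtinger derivative `∂h/∂z̄_q (z) = ½ (Dh(z)(e_q) + i · Dh(z)(i e_q))`, where `Dh(z)`
is the real Fréchet derivative and `e_q` is the `q`-th standard basis vector of `ℂⁿ`. -/
noncomputable def wirtingerDBar (n : ℕ) (q : Fin n) (h : (Fin n → ℂ) → ℂ)
    (z : Fin n → ℂ) : ℂ :=
  (1 / 2 : ℂ) * (fderiv ℝ h z (Pi.single q 1) + Complex.I * fderiv ℝ h z (Pi.single q Complex.I))

/-- `h` is holomorphic in the variables `z_l` for all `l > q` on `U`: for each `z ∈ U` and each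
`l > q`, the single-variable function `w ↦ h(z₁,…,z_{l-1},w,z_{l+1},…,zₙ)` is complex
differentiable at `z_l`. -/
def HolomorphicInVarsAfter (n : ℕ) (q : Fin n) (U : Set (Fin n → ℂ))
    (h : (Fin n → ℂ) → ℂ) : Prop :=
  ∀ z ∈ U, ∀ l : Fin n, q < l →
    DifferentiableAt ℂ (fun w : ℂ => h (Function.update z l w)) (z l)

open MeasureTheory Set Complex in
/-- The Cauchy kernel is locally integrable on `ℂ`. -/
theorem locallyIntegrable_inv_complex : LocallyIntegrable (fun t : ℂ => t⁻¹) := by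
  refine locallyIntegrable_of_norm_le_rpow (C := 1) (α := 1) ?_ ?_ ?_ ?_
  · simp [Complex.finrank_real_complex]
  · simp [Complex.finrank_real_complex]
  · exact Filter.Eventually.of_forall fun t => by simp [Real.rpow_neg_one]
  · exact measurable_inv.aestronglyMeasurable

theorem ContinuousLinearMap.rotate_dbar (L : ℂ →L[ℝ] ℂ) (θ : ℝ) :
    L (Complex.exp (θ * Complex.I)) + Complex.I * L (Complex.I * Complex.exp (θ * Complex.I)) =
      (Complex.exp (θ * Complex.I))⁻¹ * (L 1 + Complex.I * L Complex.I) := by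
  have key : ∀ a b : ℝ, L (a + b * Complex.I) = a * L 1 + b * L Complex.I := fun a b => by
    have : (a + b * Complex.I : ℂ) = a • (1 : ℂ) + b • Complex.I := by simp
    rw [this, map_add, map_smul, map_smul]
    simp
  have h1 := key (Real.cos θ) (Real.sin θ)
  have h2 := key (-Real.sin θ) (Real.cos θ)
  rw [← Complex.exp_neg, show -((θ : ℂ) * Complex.I) = ((-θ : ℝ) : ℂ) * Complex.I by simp,
    Complex.exp_mul_I, Complex.exp_mul_I]
  push_cast at h1 h2 ⊢
  rw [h1, show Complex.I * (Complex.cos θ + Complex.sin θ * Complex.I) =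
    -Complex.sin θ + Complex.cos θ * Complex.I by ring_nf; simp; ring, h2, Complex.cos_neg,
    Complex.sin_neg]
  linear_combination (Complex.sin θ * L Complex.I) * Complex.I_sq

open MeasureTheory Set in
/-- A continuous function on `ℝ × ℝ` which vanishes for large radii is integrable on the target
of polar coordinates. -/
theorem integrableOn_polarCoord_target_of_continuous {F : ℝ × ℝ → ℂ} (hF : Continuous F) {R : ℝ}
    (h0 : ∀ p : ℝ × ℝ, R < p.1 → F p = 0) : IntegrableOn F polarCoord.target := by
  have hK : IntegrableOn F (Icc 0 R ×ˢ Icc (-Real.pi) Real.pi) :=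
    hF.continuousOn.integrableOn_compact (isCompact_Icc.prod isCompact_Icc)
  refine hK.of_forall_sdiff_eq_zero polarCoord.open_target.measurableSet ?_
  rintro p ⟨⟨h1, h2⟩, h3⟩
  refine h0 p (lt_of_not_ge fun h => h3 ⟨⟨le_of_lt h1, h⟩, Ioo_subset_Icc_self h2⟩)

open MeasureTheory Set Complex in
/-- The **Cauchy–Pompeiu formula** at the origin for compactly supported functions. -/
theorem integral_inv_mul_dbar {v : ℂ → ℂ} (hv : ContDiff ℝ 1 v) (hc : HasCompactSupport v) :
    ∫ t, t⁻¹ * (fderiv ℝ v t 1 + I * fderiv ℝ v t I) = -(2 * Real.pi * v 0) := by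
  obtain ⟨R, hR⟩ : ∃ R : ℝ, ∀ t : ℂ, R < ‖t‖ → fderiv ℝ v t = 0 := by
    obtain ⟨R, hR⟩ := (hc.fderiv ℝ).isCompact.isBounded.exists_norm_le
    exact ⟨R, fun t ht => by_contra fun h => absurd (hR t (subset_tsupport _ h)) (not_le.2 ht)⟩
  have hv' : Continuous (fderiv ℝ v) := hv.continuous_fderiv one_ne_zero
  have hd : Differentiable ℝ v := hv.differentiable one_ne_zero
  let e : ℝ → ℂ := fun θ => exp (θ * I)
  have he : Continuous e := by fun_prop
  have hen : ∀ θ, ‖e θ‖ = 1 := fun θ => norm_exp_ofReal_mul_I θ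
  have hde : ∀ θ, HasDerivAt e (I * e θ) θ := fun θ => by
    have := ((hasDerivAt_id (θ : ℂ)).mul_const I).cexp.comp_ofReal
    simpa [e, mul_comm] using this
  let A : ℝ × ℝ → ℂ := fun p => fderiv ℝ v (p.1 * e p.2) (e p.2)
  let B : ℝ × ℝ → ℂ := fun p => fderiv ℝ v (p.1 * e p.2) (I * e p.2)
  have hpt : Continuous fun p : ℝ × ℝ => (p.1 : ℂ) * e p.2 := by fun_prop
  have hzero : ∀ p : ℝ × ℝ, R < p.1 → fderiv ℝ v (p.1 * e p.2) = 0 := fun p hp =>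
    hR _ (by simpa [hen] using lt_of_lt_of_le hp (le_abs_self _))
  have hA : IntegrableOn A polarCoord.target :=
    integrableOn_polarCoord_target_of_continuous
      ((hv'.comp hpt).clm_apply (by fun_prop)) (R := R) fun p hp => by simp [A, hzero p hp]
  have hB : IntegrableOn B polarCoord.target :=
    integrableOn_polarCoord_target_of_continuous
      ((hv'.comp hpt).clm_apply (by fun_prop)) (R := R) fun p hp => by simp [B, hzero p hp]
  have hpol : ∫ t, t⁻¹ * (fderiv ℝ v t 1 + I * fderiv ℝ v t I) =
      ∫ p in polarCoord.target, (A p + I * B p) := by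
    rw [← Complex.integral_comp_polarCoord_symm]
    refine setIntegral_congr_fun polarCoord.open_target.measurableSet fun p hp => ?_
    have hp1 : (p.1 : ℂ) ≠ 0 := by exact_mod_cast (ne_of_gt hp.1)
    have hs : Complex.polarCoord.symm p = p.1 * e p.2 := by
      simp [e, exp_mul_I]
    have := (fderiv ℝ v (p.1 * e p.2)).rotate_dbar p.2
    simp only [A, B, hs]
    rw [this, real_smul, mul_inv, ← mul_assoc, ← mul_assoc, mul_inv_cancel₀ hp1, one_mul]
  have hAint : ∫ p in polarCoord.target, A p = -(2 * Real.pi * v 0) := by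
    have hθ : ∀ θ : ℝ, ∫ r in Ioi (0 : ℝ), A (r, θ) = - v 0 := fun θ => by
      let w : ℝ → ℂ := fun r => v (r * e θ)
      have hw : ∀ r, HasDerivAt w (A (r, θ)) r := fun r => by
        have h1 : HasDerivAt (fun r : ℝ => (r : ℂ) * e θ) (e θ) r := by
          simpa using (hasDerivAt_id (r : ℂ)).comp_ofReal.mul_const (e θ)
        exact (hd _).hasFDerivAt.comp_hasDerivAt r h1
      have hwc : HasCompactSupport w := by
        refine hc.comp_isClosedEmbedding (g := fun r : ℝ => (r : ℂ) * e θ) ?_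
        refine Isometry.isClosedEmbedding (Isometry.of_dist_eq fun a b => ?_)
        rw [dist_eq_norm, ← sub_mul, norm_mul, hen, mul_one, ← ofReal_sub, norm_real,
          dist_eq_norm]
      have hws : ContDiff ℝ 1 w := by
        refine hv.comp (ContDiff.mul ?_ contDiff_const)
        exact ofRealCLM.contDiff
      have := hwc.integral_Ioi_deriv_eq hws 0
      simpa [funext fun r => (hw r).deriv, w] using this
    rw [polarCoord_target, Measure.volume_eq_prod, ← Measure.prod_restrict, integral_prod_symm]
    · simp only [hθ, integral_const]
      simp [Real.pi_pos.le]
      left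
      ring
    · rw [Measure.prod_restrict]; exact hA
  have hBint : ∫ p in polarCoord.target, B p = 0 := by
    rw [polarCoord_target, Measure.volume_eq_prod, setIntegral_prod _ hB]
    refine (setIntegral_congr_fun measurableSet_Ioi fun r hr => ?_).trans (integral_zero _ _)
    have hr0 : (r : ℂ) ≠ 0 := by exact_mod_cast (ne_of_gt hr)
    have hw : ∀ θ, HasDerivAt (fun θ => v (r * e θ)) (r * B (r, θ)) θ := fun θ => by
      have := (hd (r * e θ)).hasFDerivAt.comp_hasDerivAt θ ((hde θ).const_mul (r : ℂ))
      rw [← real_smul (x := r) (z := I * e θ), map_smul, real_smul] at this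
      exact this
    have hcont : Continuous fun θ => (r : ℂ) * B (r, θ) :=
      continuous_const.mul ((hv'.comp (by fun_prop)).clm_apply (by fun_prop))
    have := intervalIntegral.integral_eq_sub_of_hasDerivAt (fun θ _ => hw θ)
      (hcont.intervalIntegrable (-Real.pi) Real.pi)
    have hper : e Real.pi = e (-Real.pi) := by simp [e, exp_neg]
    rw [hper, sub_self, intervalIntegral.integral_const_mul,
      intervalIntegral.integral_of_le (by linarith [Real.pi_pos]), integral_Ioc_eq_integral_Ioo]
      at this
    simpa [hr0] using this
  rw [hpol, integral_add hA (hB.const_mul I), integral_const_mul, hAint, hBint]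
  simp

section ParametrizedCauchyTransform

open MeasureTheory Set Convolution
open Complex (I)

/-- The Cauchy transform `ζ ↦ ∫ F ξ / (ζ - ξ)` of a function on `ℂ`, up to the factor `π⁻¹`,
written as a convolution. -/
noncomputable def cauchyConv (F : ℂ → ℂ) : ℂ → ℂ :=
  (fun t : ℂ => t⁻¹) ⋆[ContinuousLinearMap.mul ℝ ℂ] F

variable {P : Type*} [NormedAddCommGroup P] [NormedSpace ℝ P] {F : P → ℂ → ℂ} {k : Set ℂ}

theorem contDiff_cauchyConv_param {n : ℕ∞} (hk : IsCompact k) (hFk : ∀ z, ∀ ζ ∉ k, F z ζ = 0)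
    (hF : ContDiff ℝ n ↿F) : ContDiff ℝ n fun q : P × ℂ => cauchyConv (F q.1) q.2 := by
  have := contDiffOn_convolution_right_with_param (μ := volume) (ContinuousLinearMap.mul ℝ ℂ)
    isOpen_univ hk (fun z ζ _ => hFk z ζ) locallyIntegrable_inv_complex
    (hF.contDiffOn (s := univ ×ˢ univ))
  rwa [univ_prod_univ, contDiffOn_univ] at this

theorem hasCompactSupport_fderiv_param (hk : IsCompact k) (hFk : ∀ z, ∀ ζ ∉ k, F z ζ = 0)
    (z : P) : HasCompactSupport fun ζ => fderiv ℝ ↿F (z, ζ) := by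
  refine HasCompactSupport.intro hk fun ζ hζ => ?_
  have : ↿F =ᶠ[nhds (z, ζ)] fun _ => 0 := by
    filter_upwards [(hk.isClosed.isOpen_compl.preimage continuous_snd).mem_nhds
      (show (z, ζ) ∈ Prod.snd ⁻¹' kᶜ from hζ)] with q hq
    exact hFk q.1 q.2 hq
  simp [this.fderiv_eq]

theorem fderiv_cauchyConv_param (hk : IsCompact k) (hFk : ∀ z, ∀ ζ ∉ k, F z ζ = 0)
    (hF : ContDiff ℝ 1 ↿F) (q v : P × ℂ) :
    fderiv ℝ (fun q : P × ℂ => cauchyConv (F q.1) q.2) q v =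
      cauchyConv (fun ζ => fderiv ℝ ↿F (q.1, ζ) v) q.2 := by
  have h := hasFDerivAt_convolution_right_with_param (μ := volume) (ContinuousLinearMap.mul ℝ ℂ)
    isOpen_univ hk (fun z ζ _ => hFk z ζ) locallyIntegrable_inv_complex
    (hF.contDiffOn (s := univ ×ˢ univ)) q (mem_univ _)
  have hcont : Continuous fun ζ => fderiv ℝ ↿F (q.1, ζ) :=
    (hF.continuous_fderiv one_ne_zero).comp (by fun_prop)
  have := convolution_precompR_apply (μ := volume) (ContinuousLinearMap.mul ℝ ℂ)
    locallyIntegrable_inv_complex (hasCompactSupport_fderiv_param hk hFk q.1) hcont q.2 v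
  exact (congrArg (· v) h.fderiv).trans this

theorem fderiv_cauchyConv_dbar (hk : IsCompact k) (hFk : ∀ z, ∀ ζ ∉ k, F z ζ = 0)
    (hF : ContDiff ℝ 1 ↿F) (q v w : P × ℂ) :
    fderiv ℝ (fun q : P × ℂ => cauchyConv (F q.1) q.2) q v +
      I * fderiv ℝ (fun q : P × ℂ => cauchyConv (F q.1) q.2) q w =
      cauchyConv (fun ζ => fderiv ℝ ↿F (q.1, ζ) v + I * fderiv ℝ ↿F (q.1, ζ) w) q.2 := by
  have hint : ∀ v, Integrable fun t : ℂ => t⁻¹ * fderiv ℝ ↿F (q.1, q.2 - t) v := fun v => by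
    have hcont : Continuous fun ζ => fderiv ℝ ↿F (q.1, ζ) v :=
      ((hF.continuous_fderiv one_ne_zero).comp (by fun_prop)).clm_apply continuous_const
    have hc : HasCompactSupport fun ζ => fderiv ℝ ↿F (q.1, ζ) v :=
      (hasCompactSupport_fderiv_param hk hFk q.1).comp_left
        (g := fun L : P × ℂ →L[ℝ] ℂ => L v) (by simp)
    exact hc.convolutionExists_right (ContinuousLinearMap.mul ℝ ℂ) locallyIntegrable_inv_complex
      hcont q.2
  rw [fderiv_cauchyConv_param hk hFk hF, fderiv_cauchyConv_param hk hFk hF]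
  simp only [cauchyConv, convolution, ContinuousLinearMap.mul_apply']
  rw [← integral_const_mul, ← integral_add (hint v) ((hint w).const_mul I)]
  congr 1 with t
  ring

theorem cauchyConv_dbar {u : ℂ → ℂ} (hu : ContDiff ℝ 1 u) (hc : HasCompactSupport u) (y : ℂ) :
    cauchyConv (fun ζ => fderiv ℝ u ζ 1 + I * fderiv ℝ u ζ I) y = 2 * Real.pi * u y := by
  have hsub : ∀ t, fderiv ℝ (fun t => u (y - t)) t = -fderiv ℝ u (y - t) := fun t => by
    have h := ((hu.differentiable one_ne_zero (y - t)).hasFDerivAt.comp t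
      ((hasFDerivAt_id (𝕜 := ℝ) t).const_sub y)).fderiv
    refine h.trans ?_
    ext
    simp
  have := integral_inv_mul_dbar (v := fun t => u (y - t)) (hu.comp (contDiff_const.sub contDiff_id))
    (hc.comp_homeomorph (Homeomorph.subLeft y))
  simp only [hsub, sub_zero] at this
  rw [← neg_neg (2 * Real.pi * u y), ← this, ← integral_neg]
  simp only [cauchyConv, convolution, ContinuousLinearMap.mul_apply']
  congr 1 with t
  simp
  ring

end ParametrizedCauchyTransform

section HolomorphicInVariables

open Function Set
open Complex (I)

theorem hasFDerivAt_comp_update {n : ℕ} {h : (Fin n → ℂ) → ℂ} {z : Fin n → ℂ} {l : Fin n}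
    {h' : (Fin n → ℂ) →L[ℝ] ℂ} (hd : HasFDerivAt h h' z) :
    HasFDerivAt (fun w => h (update z l w)) (h'.comp (ContinuousLinearMap.single ℝ (fun _ => ℂ) l)) (z l) := by
  have hu : HasFDerivAt (update z l) (ContinuousLinearMap.single ℝ (fun _ => ℂ) l) (z l) := by
    refine (hasFDerivAt_update (𝕜 := ℝ) z (i := l) (z l)).congr_fderiv ?_
    ext c i
    rcases eq_or_ne i l with rfl | hi <;> simp [*]
  rw [← update_eq_self l z] at hd
  exact hd.comp (z l) hu

/-- The Cauchy–Riemann equation in one of several complex variables. -/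
theorem differentiableAt_comp_update_iff {n : ℕ} {h : (Fin n → ℂ) → ℂ} {z : Fin n → ℂ} {l : Fin n}
    (hd : DifferentiableAt ℝ h z) :
    DifferentiableAt ℂ (fun w => h (update z l w)) (z l) ↔
      fderiv ℝ h z (Pi.single l 1) + I * fderiv ℝ h z (Pi.single l I) = 0 := by
  have h1 := hasFDerivAt_comp_update (l := l) hd.hasFDerivAt
  rw [differentiableAt_complex_iff_differentiableAt_real, h1.fderiv]
  simp only [h1.differentiableAt, true_and, ContinuousLinearMap.comp_apply,
    ContinuousLinearMap.single_apply, smul_eq_mul]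
  constructor <;> intro hcr
  · rw [hcr]; linear_combination fderiv ℝ h z (Pi.single l 1) * Complex.I_sq
  · linear_combination -I * hcr + fderiv ℝ h z (Pi.single l I) * Complex.I_sq

/-- A smooth function on `ℂⁿ` agrees near a point with a globally smooth function. -/
theorem exists_contDiff_eqOn_ball {n : ℕ} {f : (Fin n → ℂ) → ℂ} {p : Fin n → ℂ} {R : ℝ}
    (hR : 0 < R) (hf : ContDiffOn ℝ (⊤ : ℕ∞) f (Metric.ball p R)) :
    ∃ h : (Fin n → ℂ) → ℂ, ContDiff ℝ (⊤ : ℕ∞) h ∧ EqOn h f (Metric.ball p (R / 2)) := by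
  let χ : ContDiffBump p := ⟨R / 2, 3 * R / 4, by linarith, by linarith⟩
  refine ⟨fun z => (χ z : ℂ) * f z, ?_, fun z hz => ?_⟩
  · have hχ : ContDiff ℝ (⊤ : ℕ∞) fun z => (χ z : ℂ) := Complex.ofRealCLM.contDiff.comp χ.contDiff
    refine contDiff_of_contDiffOn_union_of_isOpen (hχ.contDiffOn.mul hf)
      (t := (Metric.closedBall p (3 * R / 4))ᶜ) ?_ ?_ Metric.isOpen_ball
      Metric.isClosed_closedBall.isOpen_compl
    · refine (contDiffOn_const (c := (0 : ℂ))).congr fun z hz => ?_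
      rw [χ.zero_of_le_dist (le_of_lt (by simpa using hz))]
      simp
    · refine eq_univ_of_forall fun z => ?_
      simp only [mem_union, Metric.mem_ball, mem_compl_iff, Metric.mem_closedBall, not_le]
      exact (lt_or_ge _ _).imp_right fun h => by linarith
  · simp [χ.one_of_mem_closedBall (Metric.ball_subset_closedBall hz)]

/-- Local solvability of `∂g/∂z̄_q = h` in one variable with holomorphic dependence on
parameters: the solution exists on a smaller polydisc depending only on the domain of `h`. -/
theorem exists_wirtingerDBar_eq_on_ball {n : ℕ} {q : Fin n} {h : (Fin n → ℂ) → ℂ}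
    {p : Fin n → ℂ} {R : ℝ} (hR : 0 < R) (hh : ContDiff ℝ (⊤ : ℕ∞) h)
    (hhol : HolomorphicInVarsAfter n q (Metric.ball p R) h) :
    ∃ g : (Fin n → ℂ) → ℂ, ContDiff ℝ (⊤ : ℕ∞) g ∧
      HolomorphicInVarsAfter n q (Metric.ball p (R / 2)) g ∧
      ∀ z ∈ Metric.ball p (R / 2), wirtingerDBar n q g z = h z := by
  let φ : ContDiffBump (p q) := ⟨R / 2, R, by linarith, by linarith⟩
  let k := Metric.closedBall (p q) R
  let F : (Fin n → ℂ) → ℂ → ℂ := fun z ζ => (φ ζ : ℂ) * h (update z q ζ)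
  have hk : IsCompact k := isCompact_closedBall _ _
  have hφ0 : ∀ ζ ∉ Metric.ball (p q) R, (φ ζ : ℂ) = 0 := fun ζ hζ => by
    rw [φ.zero_of_le_dist (by simpa using hζ), Complex.ofReal_zero]
  have hFk : ∀ z, ∀ ζ ∉ k, F z ζ = 0 := fun z ζ hζ => by
    simp only [F, hφ0 ζ fun h => hζ (Metric.ball_subset_closedBall h), zero_mul]
  have hupd : ContDiff ℝ (⊤ : ℕ∞) fun y : (Fin n → ℂ) × ℂ => update y.1 q y.2 := by
    refine contDiff_pi.2 fun i => ?_
    rcases eq_or_ne i q with rfl | hi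
    · simpa using contDiff_snd
    · simp only [update_of_ne hi]
      exact (contDiff_apply ℝ ℂ i).comp contDiff_fst
  have hF : ContDiff ℝ (⊤ : ℕ∞) ↿F :=
    (Complex.ofRealCLM.contDiff.comp (φ.contDiff.comp contDiff_snd)).mul (hh.comp hupd)
  have hF1 : ContDiff ℝ 1 ↿F := hF.of_le (by exact_mod_cast le_top)
  have hFd : Differentiable ℝ ↿F := hF1.differentiable one_ne_zero
  -- Partial derivatives of `F` in the parameter and in the variable of integration.
  have hF_left : ∀ z ζ, HasFDerivAt (fun z => F z ζ)
      ((fderiv ℝ ↿F (z, ζ)).comp (ContinuousLinearMap.inl ℝ _ _)) z := fun z ζ =>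
    HasFDerivAt.comp (g := ↿F) (f := fun z => (z, ζ)) z (hFd (z, ζ)).hasFDerivAt (hasFDerivAt_prodMk_left z ζ)
  have hF_right : ∀ z ζ, HasFDerivAt (F z)
      ((fderiv ℝ ↿F (z, ζ)).comp (ContinuousLinearMap.inr ℝ _ _)) ζ := fun z ζ =>
    HasFDerivAt.comp (g := ↿F) (f := fun ζ => (z, ζ)) ζ (hFd (z, ζ)).hasFDerivAt (hasFDerivAt_prodMk_right z ζ)
  let T : (Fin n → ℂ) × ℂ → ℂ := fun y => cauchyConv (F y.1) y.2
  have hT : ContDiff ℝ (⊤ : ℕ∞) T := contDiff_cauchyConv_param hk hFk hF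
  let g : (Fin n → ℂ) → ℂ := fun z => (Real.pi : ℂ)⁻¹ * T (z, z q)
  have hg : ContDiff ℝ (⊤ : ℕ∞) g :=
    contDiff_const.mul (hT.comp (contDiff_id.prodMk (contDiff_apply ℝ ℂ q)))
  have hg' : ∀ z v, fderiv ℝ g z v = (Real.pi : ℂ)⁻¹ * fderiv ℝ T (z, z q) (v, v q) := fun z v => by
    have h1 : HasFDerivAt (fun z : Fin n → ℂ => (z, z q))
        ((ContinuousLinearMap.id ℝ _).prod (ContinuousLinearMap.proj q)) z :=
      (hasFDerivAt_id z).prodMk (hasFDerivAt_apply q z)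
    have h2 := ((hT.differentiable (by simp) (z, z q)).hasFDerivAt.comp z h1).const_mul
      (Real.pi : ℂ)⁻¹
    exact congrArg (· v) h2.fderiv
  refine ⟨g, hg, fun z hz l hl => ?_, fun z hz => ?_⟩
  · rw [differentiableAt_comp_update_iff (hg.differentiable (by simp) z), hg', hg',
      Pi.single_eq_of_ne hl.ne, Pi.single_eq_of_ne hl.ne, mul_left_comm, ← mul_add,
      fderiv_cauchyConv_dbar hk hFk hF1]
    have : ∀ ζ, fderiv ℝ ↿F (z, ζ) (Pi.single l 1, 0) +
        I * fderiv ℝ ↿F (z, ζ) (Pi.single l I, 0) = 0 := fun ζ => by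
      have hcr := differentiableAt_comp_update_iff (l := l) (hF_left z ζ).differentiableAt
      rw [(hF_left z ζ).fderiv] at hcr
      refine hcr.1 ?_
      by_cases hζ : ζ ∈ Metric.ball (p q) R
      · have hmem : update z q ζ ∈ Metric.ball p R := by
          refine (dist_pi_lt_iff hR).2 fun i => ?_
          rcases eq_or_ne i q with rfl | hi
          · simpa using hζ
          · rw [update_of_ne hi]
            exact (dist_le_pi_dist z p i).trans_lt (lt_trans hz (half_lt_self hR))
        have := (hhol _ hmem l hl).const_mul (φ ζ : ℂ)
        simpa [F, update_comm hl.ne, hl.ne'] using this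
      · simp [F, hφ0 ζ hζ]
    simp [this, cauchyConv, MeasureTheory.convolution]
  · have hFq : ∀ ζ c, fderiv ℝ ↿F (z, ζ) (Pi.single q c, c) = fderiv ℝ (F z) ζ c := fun ζ c => by
      have h0 : fderiv ℝ ↿F (z, ζ) (Pi.single q c, 0) = 0 := by
        have h1 := hasFDerivAt_comp_update (l := q) (hF_left z ζ)
        have h2 : HasFDerivAt (fun w => F (update z q w) ζ) (0 : ℂ →L[ℝ] ℂ) (z q) := by
          simpa [F] using hasFDerivAt_const (F z ζ) (z q)
        simpa using congrArg (· c) (h1.unique h2)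
      have hsplit : ((Pi.single q c, c) : (Fin n → ℂ) × ℂ) = (Pi.single q c, 0) + (0, c) := by simp
      rw [hsplit, map_add, h0, zero_add, (hF_right z ζ).fderiv]
      simp
    rw [wirtingerDBar, hg', hg', mul_left_comm I, ← mul_add, fderiv_cauchyConv_dbar hk hFk hF1]
    simp only [Pi.single_eq_same, hFq]
    rw [cauchyConv_dbar (u := F z) (hF1.comp (f := fun ζ => (z, ζ)) (by fun_prop)) (HasCompactSupport.intro hk (hFk z))]
    have hφ1 : (φ (z q) : ℂ) = 1 := by
      rw [φ.one_of_mem_closedBall, Complex.ofReal_one]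
      exact (dist_le_pi_dist z p q).trans (le_of_lt hz)
    have hpi : (Real.pi : ℂ) ≠ 0 := by exact_mod_cast Real.pi_ne_zero
    simp only [F, hφ1, update_eq_self]
    field_simp

/-- `∂/∂z̄_q` is linear over holomorphic functions. -/
theorem wirtingerDBar_sum_mul {n : ℕ} {ι : Type*} [Fintype ι] {q : Fin n}
    {x g : ι → (Fin n → ℂ) → ℂ} {z : Fin n → ℂ} (hx : ∀ j, DifferentiableAt ℂ (x j) z)
    (hg : ∀ j, DifferentiableAt ℝ (g j) z) :
    wirtingerDBar n q (fun w => ∑ j, x j w * g j w) z =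
      ∑ j, x j z * wirtingerDBar n q (g j) z := by
  have hxR : ∀ j, DifferentiableAt ℝ (x j) z := fun j => (hx j).restrictScalars ℝ
  have hlin : ∀ j, fderiv ℝ (x j) z (Pi.single q I) = I * fderiv ℝ (x j) z (Pi.single q 1) :=
    fun j => by
      rw [(hx j).fderiv_restrictScalars ℝ, ContinuousLinearMap.coe_restrictScalars', ← smul_eq_mul,
        ← map_smul, ← Pi.single_smul, smul_eq_mul, mul_one]
  have hsum : ∀ v, fderiv ℝ (fun w => ∑ j, x j w * g j w) z v =
      ∑ j, (x j z * fderiv ℝ (g j) z v + g j z * fderiv ℝ (x j) z v) := fun v => by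
    rw [fderiv_fun_sum fun j _ => (hxR j).fun_mul (hg j), _root_.sum_apply]
    exact Finset.sum_congr rfl fun j _ => by simp [fderiv_fun_mul (hxR j) (hg j)]
  simp only [wirtingerDBar, hsum, Finset.mul_sum, ← Finset.sum_add_distrib, hlin]
  refine Finset.sum_congr rfl fun j _ => ?_
  linear_combination (1 / 2 * g j z * fderiv ℝ (x j) z (Pi.single q 1)) * Complex.I_sq

end HolomorphicInVariables

/-- Lemma 4.1 of the paper.  Let `U ⊆ ℂⁿ` be open, `q` an index, and
`x₁,…,x_k : U → ℂ` holomorphic.  Let `f₁,…,f_k : U → ℂ` be `C^∞`, each holomorphic in the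
variables `z_l` for `l > q`, and set `f = ∑ x_j f_j`.  Then around every point `p ∈ U` there
is an open `V ∋ p`, `V ⊆ U`, and `C^∞` functions `g₁,…,g_k` on `V`, each holomorphic in the
variables `z_l` for `l > q`, such that `g = ∑ x_j g_j` satisfies `∂g/∂z̄_q = f` on `V` and `g`
is holomorphic in the variables `z_l` for `l > q`. -/
theorem stmt_5 (n k : ℕ) (U : Set (Fin n → ℂ)) (hU : IsOpen U) (q : Fin n)
    (x : Fin k → (Fin n → ℂ) → ℂ) (hx : ∀ j, ∀ z ∈ U, DifferentiableAt ℂ (x j) z)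
    (f : Fin k → (Fin n → ℂ) → ℂ)
    (hf : ∀ j, ContDiffOn ℝ (⊤ : ℕ∞) (f j) U)
    (hfhol : ∀ j, HolomorphicInVarsAfter n q U (f j))
    (p : Fin n → ℂ) (hp : p ∈ U) :
    ∃ V : Set (Fin n → ℂ), IsOpen V ∧ p ∈ V ∧ V ⊆ U ∧
      ∃ g : Fin k → (Fin n → ℂ) → ℂ,
        (∀ j, ContDiffOn ℝ (⊤ : ℕ∞) (g j) V) ∧
        (∀ j, HolomorphicInVarsAfter n q V (g j)) ∧
        (∀ z ∈ V, wirtingerDBar n q (fun w => ∑ j, x j w * g j w) z =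
          ∑ j, x j z * f j z) ∧
        HolomorphicInVarsAfter n q V (fun w => ∑ j, x j w * g j w) := by
  obtain ⟨R, hR, hRU⟩ := Metric.isOpen_iff.1 hU p hp
  choose h hh hhf using fun j => exists_contDiff_eqOn_ball hR ((hf j).mono hRU)
  have hsub : Metric.ball p (R / 2) ⊆ U := (Metric.ball_subset_ball (by linarith)).trans hRU
  have hhhol : ∀ j, HolomorphicInVarsAfter n q (Metric.ball p (R / 2)) (h j) :=
    fun j z hz l hl => (hfhol j z (hsub hz) l hl).congr_of_eventuallyEq <| by
      have hc : Filter.Tendsto (Function.update z l) (nhds (z l)) (nhds z) := by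
        simpa using (hasFDerivAt_update (𝕜 := ℂ) z (i := l) (z l)).continuousAt.tendsto
      filter_upwards [hc (Metric.isOpen_ball.mem_nhds hz)] with w hw using hhf j hw
  choose g hg hghol hgd using fun j =>
    exists_wirtingerDBar_eq_on_ball (half_pos hR) (hh j) (hhhol j)
  have hVW : Metric.ball p (R / 2 / 2) ⊆ Metric.ball p (R / 2) :=
    Metric.ball_subset_ball (by linarith)
  refine ⟨Metric.ball p (R / 2 / 2), Metric.isOpen_ball, Metric.mem_ball_self (by linarith),
    hVW.trans hsub, g, fun j => (hg j).contDiffOn, hghol, fun z hz => ?_, fun z hz l hl => ?_⟩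
  · have hgz : ∀ j, DifferentiableAt ℝ (g j) z := fun j => (hg j).differentiable (by simp) z
    rw [wirtingerDBar_sum_mul (fun j => hx j z (hsub (hVW hz))) hgz]
    exact Finset.sum_congr rfl fun j _ => by rw [hgd j z hz, hhf j (hVW hz)]
  · refine DifferentiableAt.fun_sum fun j _ => DifferentiableAt.fun_mul ?_ (hghol j z hz l hl)
    refine DifferentiableAt.comp (g := x j) (z l) ?_ (hasFDerivAt_update z (z l)).differentiableAt
    simpa using hx j z (hsub (hVW hz))
end

section
/- Let $k$ be a field, $V$ a $k$-vector space, and $\partial, \bar\partial : V \to V$ linear maps satisfying $\partial \circ \partial = 0$, $\bar\partial \circ \bar\partial = 0$, and $\partial \circ \bar\partial + \bar\partial \circ \partial = 0$. Assume the $\partial\bar\partial$-property: for every $\omega \in V$ with $\partial \omega = 0$ and $\bar\partial \omega = 0$, if $\omega \in \operatorname{range}\partial$ or $\omega \in \operatorname{range}\bar\partial$, then $\omega \in \operatorname{range}(\partial \circ \bar\partial)$. Then $\operatorname{range}(\partial\circ\bar\partial) \subseteq \ker\partial \cap \ker\bar\partial$, $\operatorname{range}(\partial\circ\bar\partial) \subseteq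 \operatorname{range}\bar\partial \subseteq \ker\bar\partial$, and the inclusion $\ker\partial \cap \ker\bar\partial \subseteq \ker\bar\partial$ induces a linear isomorphism $(\ker\partial \cap \ker\bar\partial)\,/\,\operatorname{range}(\partial\circ\bar\partial) \;\cong\; \ker\bar\partial\,/\,\operatorname{range}\bar\partial.$ -/
/-- Let `V` be a `k`-vector space and `∂, ∂̄ : V → V` linear maps with
`∂² = 0`, `∂̄² = 0`, `∂∂̄ + ∂̄∂ = 0`, satisfying the `∂∂̄`-property: any `ω` killed by both
`∂` and `∂̄` which is `∂`-exact or `∂̄`-exact lies in the range of `∂∂̄`.  Then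
`range(∂∂̄) ⊆ ker ∂ ∩ ker ∂̄`, `range(∂∂̄) ⊆ range ∂̄ ⊆ ker ∂̄`, and the inclusion
`ker ∂ ∩ ker ∂̄ ⊆ ker ∂̄` induces a linear isomorphism
`(ker ∂ ∩ ker ∂̄)/range(∂∂̄) ≅ ker ∂̄ / range ∂̄`. -/
theorem stmt_7 {k V : Type*} [Field k] [AddCommGroup V] [Module k V]
    (d db : V →ₗ[k] V)
    (hd : d ∘ₗ d = 0) (hdb : db ∘ₗ db = 0) (hanti : d ∘ₗ db + db ∘ₗ d = 0)
    (ddbar : ∀ ω : V, d ω = 0 → db ω = 0 →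
      (ω ∈ LinearMap.range d ∨ ω ∈ LinearMap.range db) → ω ∈ LinearMap.range (d ∘ₗ db)) :
    LinearMap.range (d ∘ₗ db) ≤ LinearMap.ker d ⊓ LinearMap.ker db ∧
    LinearMap.range (d ∘ₗ db) ≤ LinearMap.range db ∧
    LinearMap.range db ≤ LinearMap.ker db ∧
    ∃ e : ((LinearMap.ker d ⊓ LinearMap.ker db : Submodule k V) ⧸
            (LinearMap.range (d ∘ₗ db)).comap
              (LinearMap.ker d ⊓ LinearMap.ker db : Submodule k V).subtype) ≃ₗ[k]
          ((LinearMap.ker db : Submodule k V) ⧸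
            (LinearMap.range db).comap (LinearMap.ker db : Submodule k V).subtype),
      ∀ x : (LinearMap.ker d ⊓ LinearMap.ker db : Submodule k V),
        e (Submodule.Quotient.mk x) =
          Submodule.Quotient.mk (Submodule.inclusion inf_le_right x) := by
  have hdd (x : V) : d (d x) = 0 := LinearMap.congr_fun hd x
  have hbb (x : V) : db (db x) = 0 := LinearMap.congr_fun hdb x
  have hdbd (x : V) : db (d x) = -d (db x) :=
    eq_neg_of_add_eq_zero_right (LinearMap.congr_fun hanti x)
  have hrange : LinearMap.range (d ∘ₗ db) ≤ LinearMap.range db := by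
    rintro _ ⟨x, rfl⟩
    exact ⟨-d x, by simp [hdbd]⟩
  refine ⟨?_, hrange, ?_, ?_⟩
  · rintro _ ⟨x, rfl⟩
    simp [hdd, hdbd, hbb]
  · rintro _ ⟨x, rfl⟩
    exact hbb x
  let f := Submodule.mapQ
    ((LinearMap.range (d ∘ₗ db)).comap
      (LinearMap.ker d ⊓ LinearMap.ker db : Submodule k V).subtype)
    ((LinearMap.range db).comap (LinearMap.ker db : Submodule k V).subtype)
    (Submodule.inclusion inf_le_right) (fun _ hx => hrange hx)
  refine ⟨LinearEquiv.ofBijective f ⟨?_, ?_⟩, fun x => rfl⟩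
  · refine (injective_iff_map_eq_zero f).2 fun q hq => ?_
    obtain ⟨x, rfl⟩ := Submodule.Quotient.mk_surjective _ q
    have hx : (x : V) ∈ LinearMap.range db :=
      (Submodule.Quotient.mk_eq_zero ((LinearMap.range db).comap
        (LinearMap.ker db : Submodule k V).subtype)
        (x := Submodule.inclusion inf_le_right x)).1 hq
    exact (Submodule.Quotient.mk_eq_zero _).2 (ddbar x x.2.1 x.2.2 (Or.inr hx))
  · intro q
    obtain ⟨⟨b, hb⟩, rfl⟩ := Submodule.Quotient.mk_surjective _ q
    have hb0 : db b = 0 := hb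
    obtain ⟨c, hc⟩ := ddbar (d b) (hdd b) (by simp [hdbd, hb0]) (Or.inl ⟨b, rfl⟩)
    have hc' : d (db c) = d b := hc
    refine ⟨Submodule.Quotient.mk ⟨b - db c, ?_, ?_⟩, (Submodule.Quotient.eq _).2 ⟨-c, ?_⟩⟩
    · simp [hc']
    · simp [hb0, hbb]
    · simp
end
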